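/- Let w > 0, let ρ_sc be the semicircle density, and let v(t) = ∫_{−2w}^{2w} e^{itλ} ρ_sc(λ) dλ. Fix t₂ ≥ 0, and define F₃(t₁, t₂) = (1/(2π²)) ∫_{−2w}^{2w} ∫_{−2w}^{2w} (e^{it₁λ₂} − e^{it₁λ₁})(e^{it₂λ₂} − e^{it₂λ₁}) (λ₁ − λ₂)^{−2} (4w² − λ₁λ₂) (4w² − λ₁²)^{−1/2} (4w² − λ₂²)^{−1/2} dλ₁ dλ₂. Then F₃(·, t₂) is the unique differentiable function of t₁ ∈ [0,∞) satisfying, for all t₁ ≥ 0, F₃(t₁, t₂) + 2w² ∫₀^{t₁} ∫₀^{t₃} v(t₃ − t₄) F₃(t₄, t₂) dt₄ dt₃ = −2w² t₂ ∫₀^{t₁} v(t₂ + t₃) dt₃. -/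

import Mathlib

open MeasureTheory Complex

/-- The semicircle density `ρ_sc(λ) = (2πw²)⁻¹ √(4w² - λ²)` (which vanishes for `|λ| > 2w`). -/
noncomputable def semicircle (w : ℝ) (lam : ℝ) : ℝ :=
  (2 * Real.pi * w ^ 2)⁻¹ * Real.sqrt (4 * w ^ 2 - lam ^ 2)

/-- `v(t) = ∫_{-2w}^{2w} e^{itλ} ρ_sc(λ) dλ`, the Fourier transform of the semicircle law. -/
noncomputable def scFourier (w : ℝ) (t : ℝ) : ℂ :=
  ∫ lam in (-(2*w))..(2*w), Complex.exp (Complex.I * t * lam) * (semicircle w lam : ℂ)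

/-- The function `F₃(t₁,t₂)` of the paper:
`(2π²)⁻¹ ∬ Δe(t₁) Δe(t₂) (λ₁-λ₂)⁻² (4w²-λ₁λ₂) ((4w²-λ₁²)(4w²-λ₂²))^{-1/2} dλ₁ dλ₂`. -/
noncomputable def Fthree (w t₁ t₂ : ℝ) : ℂ :=
  ((1 / (2 * Real.pi ^ 2) : ℝ) : ℂ)
    * ∫ lam₁ in (-(2*w))..(2*w), ∫ lam₂ in (-(2*w))..(2*w),
        (Complex.exp (Complex.I * t₁ * lam₂) - Complex.exp (Complex.I * t₁ * lam₁))
          * (Complex.exp (Complex.I * t₂ * lam₂) - Complex.exp (Complex.I * t₂ * lam₁))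
          / (((lam₁ - lam₂) ^ 2 : ℝ) : ℂ)
          * ((((4 * w ^ 2 - lam₁ * lam₂)
              / (Real.sqrt (4 * w ^ 2 - lam₁ ^ 2) * Real.sqrt (4 * w ^ 2 - lam₂ ^ 2))) : ℝ) : ℂ)

/-- The integrand `e^{i(2wt cos θ - kθ)}` of Bessel's integral. -/
noncomputable def besselWave (w : ℝ) (k : ℤ) (t θ : ℝ) : ℂ :=
  exp (((2 * w * t * Real.cos θ - k * θ : ℝ) : ℂ) * I)

/-- The `k`-th Fourier coefficient of `θ ↦ e^{2iwt cos θ}`, that is, `i^k J_k(2wt)`. -/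
noncomputable def besselCoeff (w : ℝ) (k : ℤ) (t : ℝ) : ℂ :=
  (2 * Real.pi : ℂ)⁻¹ * ∫ θ in (-Real.pi)..Real.pi, besselWave w k t θ

/-- The difference `c_{k-1} - c_{k+1}` of Fourier coefficients. -/
noncomputable def besselDiff (w : ℝ) (k : ℤ) (t : ℝ) : ℂ :=
  besselCoeff w (k - 1) t - besselCoeff w (k + 1) t

lemma two_pi_complex_ne_zero : (2 * Real.pi : ℂ) ≠ 0 := by
  simp [Real.pi_ne_zero]

lemma norm_besselWave (w : ℝ) (k : ℤ) (t θ : ℝ) : ‖besselWave w k t θ‖ = 1 :=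
  norm_exp_ofReal_mul_I _

@[fun_prop]
lemma continuous_besselWave (w : ℝ) (k : ℤ) (t : ℝ) : Continuous (besselWave w k t) := by
  unfold besselWave
  fun_prop

lemma norm_besselCoeff_le (w : ℝ) (k : ℤ) (t : ℝ) : ‖besselCoeff w k t‖ ≤ 1 := by
  have h := intervalIntegral.norm_integral_le_of_norm_le_const (a := -Real.pi) (b := Real.pi)
    (f := besselWave w k t) (C := 1) fun θ _ => (norm_besselWave w k t θ).le
  have hpi := Real.pi_pos
  rw [besselCoeff, norm_mul, norm_inv]
  have h2 : ‖(2 * Real.pi : ℂ)‖ = 2 * Real.pi := by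
    rw [norm_mul, Complex.norm_real, Real.norm_of_nonneg hpi.le]; simp
  rw [h2, inv_mul_le_iff₀ (by positivity)]
  refine h.trans (le_of_eq ?_)
  rw [abs_of_pos (by linarith)]
  ring

lemma besselCoeff_neg (w : ℝ) (k : ℤ) (t : ℝ) : besselCoeff w (-k) t = besselCoeff w k t := by
  unfold besselCoeff
  congr 1
  have h := intervalIntegral.integral_comp_neg (a := -Real.pi) (b := Real.pi)
    (besselWave w k t)
  rw [neg_neg] at h
  rw [← h]
  refine intervalIntegral.integral_congr fun θ _ => ?_
  simp [besselWave]

lemma besselDiff_neg (w : ℝ) (k : ℤ) (t : ℝ) : besselDiff w (-k) t = -besselDiff w k t := by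
  rw [besselDiff, besselDiff, ← besselCoeff_neg w (k - 1), ← besselCoeff_neg w (k + 1)]
  ring_nf

lemma norm_besselDiff_le (w : ℝ) (k : ℤ) (t : ℝ) : ‖besselDiff w k t‖ ≤ 2 :=
  (norm_sub_le _ _).trans (by
    linarith [norm_besselCoeff_le w (k - 1) t, norm_besselCoeff_le w (k + 1) t])

lemma besselWave_sub_one (w : ℝ) (k : ℤ) (t θ : ℝ) :
    besselWave w (k - 1) t θ = besselWave w k t θ * exp (θ * I) := by
  rw [besselWave, besselWave, ← exp_add]
  congr 1
  push_cast
  ring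

lemma besselWave_add_one (w : ℝ) (k : ℤ) (t θ : ℝ) :
    besselWave w (k + 1) t θ = besselWave w k t θ * exp (-(θ : ℂ) * I) := by
  rw [besselWave, besselWave, ← exp_add]
  congr 1
  push_cast
  ring

lemma besselCoeff_sub_one_add (w : ℝ) (k : ℤ) (t : ℝ) :
    besselCoeff w (k - 1) t + besselCoeff w (k + 1) t
      = (2 * Real.pi : ℂ)⁻¹ * ∫ θ in (-Real.pi)..Real.pi, 2 * cos θ * besselWave w k t θ := by
  rw [besselCoeff, besselCoeff, ← mul_add, ← intervalIntegral.integral_add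
    (Continuous.intervalIntegrable (by fun_prop) _ _)
    (Continuous.intervalIntegrable (by fun_prop) _ _)]
  congr 1
  refine intervalIntegral.integral_congr fun θ _ => ?_
  simp only [besselWave_sub_one, besselWave_add_one, Complex.cos]
  ring

lemma besselDiff_eq_integral (w : ℝ) (k : ℤ) (t : ℝ) :
    besselDiff w k t
      = (2 * Real.pi : ℂ)⁻¹ * ∫ θ in (-Real.pi)..Real.pi, 2 * I * sin θ * besselWave w k t θ := by
  rw [besselDiff, besselCoeff, besselCoeff, ← mul_sub, ← intervalIntegral.integral_sub
    (Continuous.intervalIntegrable (by fun_prop) _ _)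
    (Continuous.intervalIntegrable (by fun_prop) _ _)]
  congr 1
  refine intervalIntegral.integral_congr fun θ _ => ?_
  simp only [besselWave_sub_one, besselWave_add_one, Complex.sin]
  linear_combination (-besselWave w k t θ) * (exp (-(θ : ℂ) * I) - exp (θ * I)) * I_sq

lemma hasDerivAt_besselCoeff (w : ℝ) (k : ℤ) (t : ℝ) :
    HasDerivAt (besselCoeff w k)
      (I * w * (besselCoeff w (k - 1) t + besselCoeff w (k + 1) t)) t := by
  have hd : ∀ x θ : ℝ, HasDerivAt (fun x => besselWave w k x θ)
      (I * w * (2 * cos θ * besselWave w k x θ)) x := by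
    intro x θ
    have h1 : HasDerivAt (fun x : ℝ => 2 * w * x * Real.cos θ - k * θ) (2 * w * Real.cos θ) x := by
      simpa using (((hasDerivAt_id x).const_mul (2 * w)).mul_const (Real.cos θ)).sub_const (k * θ)
    convert! (h1.ofReal_comp.mul_const I).cexp using 1
    simp only [besselWave]
    push_cast
    ring
  have key := (intervalIntegral.hasDerivAt_integral_of_dominated_loc_of_deriv_le
    (μ := volume) (a := -Real.pi) (b := Real.pi) (F := besselWave w k)
    (F' := fun x θ => I * w * (2 * cos θ * besselWave w k x θ)) (x₀ := t) (s := Set.univ)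
    (bound := fun _ => |w| * 2) Filter.univ_mem
    (Filter.Eventually.of_forall fun x =>
      (continuous_besselWave w k x).aestronglyMeasurable)
    ((continuous_besselWave w k t).intervalIntegrable _ _)
    (Continuous.aestronglyMeasurable (by fun_prop))
    (Filter.Eventually.of_forall fun θ _ x _ => by
      rw [norm_mul, norm_mul, norm_mul, norm_mul, norm_besselWave, norm_I, ← ofReal_cos,
        norm_real, norm_real, Real.norm_eq_abs, Real.norm_eq_abs, one_mul, mul_one]
      gcongr
      have := Real.abs_cos_le_one θ
      simp only [Complex.norm_ofNat]
      linarith)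
    intervalIntegrable_const
    (Filter.Eventually.of_forall fun θ _ x _ => hd x θ)).2
  have := key.const_mul (2 * Real.pi : ℂ)⁻¹
  rw [intervalIntegral.integral_const_mul] at this
  rw [besselCoeff_sub_one_add]
  convert! this using 1
  ring

@[fun_prop]
lemma continuous_besselCoeff (w : ℝ) (k : ℤ) : Continuous (besselCoeff w k) :=
  continuous_iff_continuousAt.2 fun t => (hasDerivAt_besselCoeff w k t).continuousAt

/-- The three-term recurrence of the Bessel functions. -/
lemma int_mul_besselCoeff (w : ℝ) (k : ℤ) (t : ℝ) :
    (k : ℂ) * besselCoeff w k t = I * w * t * besselDiff w k t := by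
  have hd : ∀ θ : ℝ, HasDerivAt (besselWave w k t)
      (-(w * t) * (2 * I * sin θ * besselWave w k t θ) - k * I * besselWave w k t θ) θ := by
    intro θ
    have h1 : HasDerivAt (fun θ : ℝ => 2 * w * t * Real.cos θ - k * θ)
        (2 * w * t * (-Real.sin θ) - k) θ :=
      (((Real.hasDerivAt_cos θ).const_mul (2 * w * t)).sub
        ((hasDerivAt_id θ).const_mul (k : ℝ))).congr_deriv (by ring)
    convert! (h1.ofReal_comp.mul_const I).cexp using 1
    simp only [besselWave]
    push_cast
    ring
  have h := intervalIntegral.integral_eq_sub_of_hasDerivAt (a := -Real.pi) (b := Real.pi)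
    (fun θ _ => hd θ) (Continuous.intervalIntegrable (by fun_prop) _ _)
  have hper : besselWave w k t Real.pi - besselWave w k t (-Real.pi) = 0 := by
    rw [besselWave, besselWave, sub_eq_zero, exp_eq_exp_iff_exists_int]
    refine ⟨-k, ?_⟩
    simp only [Real.cos_neg]
    push_cast
    ring
  rw [hper, intervalIntegral.integral_sub (Continuous.intervalIntegrable (by fun_prop) _ _)
    (Continuous.intervalIntegrable (by fun_prop) _ _), intervalIntegral.integral_const_mul,
    intervalIntegral.integral_const_mul] at h
  rw [besselDiff_eq_integral, besselCoeff]
  linear_combination (2 * Real.pi : ℂ)⁻¹ * I * h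
    + (2 * Real.pi : ℂ)⁻¹ * k * (∫ θ in (-Real.pi)..Real.pi, besselWave w k t θ) * I_sq

lemma besselCoeff_zero_of_ne (w : ℝ) {k : ℤ} (hk : k ≠ 0) : besselCoeff w k 0 = 0 := by
  have h := int_mul_besselCoeff w k 0
  simpa [hk] using h

lemma besselCoeff_decay (w t : ℝ) (n : ℕ) :
    ∃ C : ℝ, 0 ≤ C ∧ ∀ k : ℤ, (1 + |(k : ℝ)|) ^ n * ‖besselCoeff w k t‖ ≤ C := by
  induction n with
  | zero => exact ⟨1, zero_le_one, fun k => by simpa using norm_besselCoeff_le w k t⟩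
  | succ n ih =>
    obtain ⟨C, hC, h⟩ := ih
    refine ⟨C + |w * t| * (2 ^ n * C + 2 ^ n * C), by positivity, fun k => ?_⟩
    have hrec : |(k : ℝ)| * ‖besselCoeff w k t‖ = |w * t| * ‖besselDiff w k t‖ := by
      have := congrArg norm (int_mul_besselCoeff w k t)
      simpa [abs_mul] using this
    have hshift : ∀ m : ℤ, |(k : ℝ) - m| ≤ 1 →
        (1 + |(k : ℝ)|) ^ n * ‖besselCoeff w m t‖ ≤ 2 ^ n * C := by
      intro m hm
      have h1 : 1 + |(k : ℝ)| ≤ 2 * (1 + |(m : ℝ)|) := by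
        have := abs_sub_abs_le_abs_sub (k : ℝ) m
        linarith [abs_nonneg (m : ℝ)]
      calc (1 + |(k : ℝ)|) ^ n * ‖besselCoeff w m t‖
          ≤ (2 * (1 + |(m : ℝ)|)) ^ n * ‖besselCoeff w m t‖ := by gcongr
        _ = 2 ^ n * ((1 + |(m : ℝ)|) ^ n * ‖besselCoeff w m t‖) := by rw [mul_pow]; ring
        _ ≤ 2 ^ n * C := by gcongr; exact h m
    have h1 := hshift (k - 1) (by push_cast; simp)
    have h2 := hshift (k + 1) (by push_cast; simp)
    have h3 : ‖besselDiff w k t‖ ≤ ‖besselCoeff w (k - 1) t‖ + ‖besselCoeff w (k + 1) t‖ :=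
      norm_sub_le _ _
    calc (1 + |(k : ℝ)|) ^ (n + 1) * ‖besselCoeff w k t‖
        = (1 + |(k : ℝ)|) ^ n * ‖besselCoeff w k t‖
          + (1 + |(k : ℝ)|) ^ n * (|(k : ℝ)| * ‖besselCoeff w k t‖) := by ring
      _ = (1 + |(k : ℝ)|) ^ n * ‖besselCoeff w k t‖
          + |w * t| * ((1 + |(k : ℝ)|) ^ n * ‖besselDiff w k t‖) := by rw [hrec]; ring
      _ ≤ C + |w * t| * ((1 + |(k : ℝ)|) ^ n *
          (‖besselCoeff w (k - 1) t‖ + ‖besselCoeff w (k + 1) t‖)) := by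
          gcongr
          exact h k
      _ ≤ C + |w * t| * (2 ^ n * C + 2 ^ n * C) := by
          rw [mul_add ((1 + |(k : ℝ)|) ^ n)]
          gcongr

lemma summable_natCast_sq_mul_norm_besselCoeff (w t : ℝ) :
    Summable fun n : ℕ => (n : ℝ) ^ 2 * ‖besselCoeff w n t‖ := by
  obtain ⟨C, hC, h⟩ := besselCoeff_decay w t 4
  have hs : Summable fun n : ℕ => C * (1 / ((n : ℝ) + 1) ^ 2) := by
    have := (summable_nat_add_iff 1).2 (Real.summable_one_div_nat_pow.2 (one_lt_two))
    simpa using this.mul_left C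
  refine Summable.of_nonneg_of_le (fun n => by positivity) (fun n => ?_) hs
  have hn := h n
  simp only [Int.cast_natCast, Nat.abs_cast] at hn
  rw [mul_one_div, le_div_iff₀ (by positivity)]
  refine le_trans ?_ hn
  have : (n : ℝ) ^ 2 * (n + 1) ^ 2 ≤ (1 + n) ^ 4 := by
    have h0 : (0 : ℝ) ≤ n := n.cast_nonneg
    nlinarith [sq_nonneg ((n : ℝ) + 1)]
  calc _ = (n : ℝ) ^ 2 * (n + 1) ^ 2 * ‖besselCoeff w n t‖ := by ring
    _ ≤ _ := by gcongr

lemma summable_norm_besselCoeff_nat (w t : ℝ) :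
    Summable fun n : ℕ => ‖besselCoeff w n t‖ := by
  rw [← summable_nat_add_iff 1]
  refine Summable.of_nonneg_of_le (fun n => by positivity) (fun n => ?_)
    ((summable_nat_add_iff 1).2 (summable_natCast_sq_mul_norm_besselCoeff w t))
  refine le_mul_of_one_le_left (norm_nonneg _) ?_
  push_cast
  nlinarith [(n.cast_nonneg : (0 : ℝ) ≤ n)]

lemma summable_natCast_mul_norm_besselCoeff (w t : ℝ) :
    Summable fun n : ℕ => (n : ℝ) * ‖besselCoeff w n t‖ := by
  refine Summable.of_nonneg_of_le (fun n => by positivity) (fun n => ?_)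
    (summable_natCast_sq_mul_norm_besselCoeff w t)
  gcongr
  exact_mod_cast Nat.le_self_pow two_ne_zero n

lemma summable_norm_besselCoeff (w t : ℝ) : Summable fun k : ℤ => ‖besselCoeff w k t‖ := by
  refine Summable.of_nat_of_neg (summable_norm_besselCoeff_nat w t) ?_
  simpa only [besselCoeff_neg] using summable_norm_besselCoeff_nat w t

lemma besselCoeff_eq_fourierCoeff (w : ℝ) (k : ℤ) (t : ℝ) [Fact (0 < 2 * Real.pi)] :
    fourierCoeff (T := 2 * Real.pi)
      (fun x : Real.Angle => exp (((2 * w * t * Real.Angle.cos x : ℝ) : ℂ) * I)) k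
      = besselCoeff w k t := by
  have h := fourierCoeff_eq_intervalIntegral (T := 2 * Real.pi)
    (fun x : Real.Angle => exp (((2 * w * t * Real.Angle.cos x : ℝ) : ℂ) * I)) k (-Real.pi)
  refine h.trans ?_
  rw [show -Real.pi + 2 * Real.pi = Real.pi by ring, besselCoeff, real_smul]
  congr 1
  · push_cast
    rw [one_div]
  · refine intervalIntegral.integral_congr fun θ _ => ?_
    have hcos : Real.Angle.cos (θ : AddCircle (2 * Real.pi)) = Real.cos θ := Real.Angle.cos_coe θ
    simp only [fourier_coe_apply, smul_eq_mul, besselWave]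
    rw [hcos, ← exp_add]
    congr 1
    have := Real.pi_ne_zero
    push_cast
    field_simp
    ring

lemma hasSum_besselCoeff_exp (w t θ : ℝ) :
    HasSum (fun k : ℤ => besselCoeff w k t * exp (k * θ * I))
      (exp (((2 * w * t * Real.cos θ : ℝ) : ℂ) * I)) := by
  have : Fact (0 < 2 * Real.pi) := ⟨by positivity⟩
  let f : C(AddCircle (2 * Real.pi), ℂ) :=
    ⟨fun x : Real.Angle => exp (((2 * w * t * Real.Angle.cos x : ℝ) : ℂ) * I),
      by have := Real.Angle.continuous_cos; fun_prop⟩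
  have hco : ∀ k, fourierCoeff f k = besselCoeff w k t := fun k =>
    besselCoeff_eq_fourierCoeff w k t
  have hs : Summable (fourierCoeff f) := by
    rw [funext hco]
    exact (summable_norm_besselCoeff w t).of_norm
  have h := has_pointwise_sum_fourier_series_of_summable hs (θ : AddCircle (2 * Real.pi))
  convert! h using 1
  funext k
  rw [hco, smul_eq_mul, fourier_coe_apply]
  congr 2
  have := Real.pi_ne_zero
  push_cast
  field_simp

lemma integral_eq_integral_two_mul_cos {w : ℝ} (hw : 0 < w) (g : ℝ → ℂ) :
    ∫ x in (-(2 * w))..(2 * w), g x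
      = ∫ θ in (0 : ℝ)..Real.pi, (2 * w * Real.sin θ) • g (2 * w * Real.cos θ) := by
  have himg : Set.image (fun θ => 2 * w * Real.cos θ) (Set.Ioo 0 Real.pi)
      = Set.Ioo (-(2 * w)) (2 * w) := by
    ext x
    constructor
    · rintro ⟨θ, hθ, rfl⟩
      have h1 : Real.cos θ < 1 := by
        rw [← Real.cos_zero]
        exact Real.cos_lt_cos_of_nonneg_of_le_pi le_rfl hθ.2.le hθ.1
      have h2 : -1 < Real.cos θ := by
        rw [← Real.cos_pi]
        exact Real.cos_lt_cos_of_nonneg_of_le_pi hθ.1.le le_rfl hθ.2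
      constructor <;> dsimp only <;> nlinarith
    · rintro ⟨h1, h2⟩
      have h3 : x / (2 * w) < 1 := by rw [div_lt_one (by positivity)]; exact h2
      have h4 : -1 < x / (2 * w) := by rw [lt_div_iff₀ (by positivity)]; linarith
      refine ⟨Real.arccos (x / (2 * w)), ⟨Real.arccos_pos.2 h3, Real.arccos_lt_pi.2 h4⟩, ?_⟩
      simp only [Real.cos_arccos h4.le h3.le]
      field_simp
  have hinj : Set.InjOn (fun θ => 2 * w * Real.cos θ) (Set.Ioo 0 Real.pi) := by
    intro a ha b hb hab
    refine Real.injOn_cos (Set.Ioo_subset_Icc_self ha) (Set.Ioo_subset_Icc_self hb) ?_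
    exact mul_left_cancel₀ (by positivity) hab
  rw [intervalIntegral.integral_of_le (by linarith), intervalIntegral.integral_of_le Real.pi_pos.le,
    integral_Ioc_eq_integral_Ioo, integral_Ioc_eq_integral_Ioo, ← himg,
    integral_image_eq_integral_abs_deriv_smul measurableSet_Ioo
      (fun θ _ => ((Real.hasDerivAt_cos θ).const_mul (2 * w)).hasDerivWithinAt) hinj]
  refine setIntegral_congr_fun measurableSet_Ioo fun θ hθ => ?_
  have := Real.sin_pos_of_mem_Ioo hθ
  rw [mul_neg, abs_neg, abs_of_pos (by positivity)]

lemma sqrt_sub_two_mul_cos_sq {w θ : ℝ} (hw : 0 < w) (hθ : θ ∈ Set.Icc 0 Real.pi) :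
    Real.sqrt (4 * w ^ 2 - (2 * w * Real.cos θ) ^ 2) = 2 * w * Real.sin θ := by
  have := Real.sin_nonneg_of_mem_Icc hθ
  rw [show 4 * w ^ 2 - (2 * w * Real.cos θ) ^ 2 = (2 * w * Real.sin θ) ^ 2 by
    rw [mul_pow _ (Real.sin θ), Real.sin_sq]; ring]
  exact Real.sqrt_sq (by positivity)

lemma integral_neg_pi_pi_eq {E : Type*} [NormedAddCommGroup E] [NormedSpace ℝ E]
    {f : ℝ → E} (hf : Continuous f) :
    ∫ θ in (-Real.pi)..Real.pi, f θ = ∫ θ in (0 : ℝ)..Real.pi, (f θ + f (-θ)) := by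
  rw [← intervalIntegral.integral_add_adjacent_intervals (hf.intervalIntegrable _ 0)
    (hf.intervalIntegrable _ _), intervalIntegral.integral_add (hf.intervalIntegrable _ _)
    (Continuous.intervalIntegrable (by fun_prop) _ _), intervalIntegral.integral_comp_neg f,
    neg_zero, add_comm]

lemma scFourier_eq_besselDiff {w : ℝ} (hw : 0 < w) (t : ℝ) :
    scFourier w t = besselDiff w 1 t := by
  rw [scFourier, integral_eq_integral_two_mul_cos hw, besselDiff_eq_integral,
    integral_neg_pi_pi_eq (by fun_prop), ← intervalIntegral.integral_const_mul]
  refine intervalIntegral.integral_congr fun θ hθ => ?_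
  rw [Set.uIcc_of_le Real.pi_pos.le] at hθ
  have hpi : (Real.pi : ℂ) ≠ 0 := by exact_mod_cast Real.pi_ne_zero
  have hw' : (w : ℂ) ≠ 0 := by exact_mod_cast hw.ne'
  have h1 : besselWave w 1 t θ = exp (I * t * (2 * w * cos θ)) * exp (-(θ * I)) := by
    rw [besselWave, ← exp_add]
    congr 1
    push_cast
    ring
  have h2 : besselWave w 1 t (-θ) = exp (I * t * (2 * w * cos θ)) * exp (θ * I) := by
    rw [besselWave, ← exp_add]
    congr 1
    push_cast
    rw [cos_neg]
    ring
  have h3 : exp (θ * I) - exp (-(θ * I)) = 2 * I * sin θ := by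
    have := two_sin (θ : ℂ)
    rw [mul_comm 2 I, mul_assoc, this, ← neg_mul]
    linear_combination (-(exp (-(θ : ℂ) * I) - exp (θ * I))) * I_sq
  simp only [h1, h2, semicircle, sqrt_sub_two_mul_cos_sq hw hθ, real_smul]
  push_cast
  rw [sin_neg]
  generalize exp (θ * I) = P at h3 ⊢
  generalize exp (-(θ * I)) = Q at h3 ⊢
  field_simp
  linear_combination I * sin θ * h3 + 2 * sin θ ^ 2 * I_sq

lemma hasSum_besselCoeff_mul (w s t : ℝ) (m : ℤ) :
    HasSum (fun k : ℤ => besselCoeff w k s * besselCoeff w (m - k) t)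
      (besselCoeff w m (s + t)) := by
  have h := intervalIntegral.hasSum_integral_of_dominated_convergence (μ := volume)
    (a := -Real.pi) (b := Real.pi)
    (F := fun (k : ℤ) θ => besselCoeff w k s * besselWave w (m - k) t θ)
    (f := besselWave w m (s + t)) (fun k _ => ‖besselCoeff w k s‖)
    (fun k => Continuous.aestronglyMeasurable (by fun_prop))
    (fun k => Filter.Eventually.of_forall fun θ _ => by
      rw [norm_mul, norm_besselWave, mul_one])
    (Filter.Eventually.of_forall fun θ _ => summable_norm_besselCoeff w s)
    intervalIntegrable_const
    (Filter.Eventually.of_forall fun θ _ => by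
      have h1 := (hasSum_besselCoeff_exp w s θ).mul_right (besselWave w m t θ)
      convert! h1 using 1
      · funext k
        rw [mul_assoc, besselWave, besselWave, ← exp_add]
        congr 2
        push_cast
        ring
      · rw [besselWave, besselWave, ← exp_add]
        congr 1
        push_cast
        ring)
  have h2 := h.mul_left (2 * Real.pi : ℂ)⁻¹
  convert! h2 using 1
  funext k
  rw [besselCoeff, besselCoeff, intervalIntegral.integral_const_mul]
  ring

lemma hasSum_besselDiff_mul {w : ℝ} (hw : 0 < w) (s t : ℝ) :
    HasSum (fun n : ℕ => besselDiff w n s * besselDiff w n t) (scFourier w (s + t)) := by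
  have h0 := (hasSum_besselCoeff_mul w s t 0).sub (hasSum_besselCoeff_mul w s t 2)
  have hv : besselCoeff w 0 (s + t) - besselCoeff w 2 (s + t) = scFourier w (s + t) := by
    rw [scFourier_eq_besselDiff hw]; rfl
  rw [hv] at h0
  have h1 : HasSum (fun k : ℤ => besselCoeff w (k - 1) s * besselDiff w k t)
      (scFourier w (s + t)) := by
    have h := (Equiv.subLeft (1 : ℤ)).hasSum_iff.2 h0
    convert! h using 1
    funext k
    simp only [Function.comp_apply, Equiv.subLeft_apply, besselDiff]
    rw [← besselCoeff_neg w (k - 1) s]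
    ring_nf
  have h2 : HasSum (fun k : ℤ => -(besselCoeff w (k + 1) s * besselDiff w k t))
      (scFourier w (s + t)) := by
    have h := (Equiv.neg ℤ).hasSum_iff.2 h1
    convert! h using 1
    funext k
    simp only [Function.comp_apply, Equiv.neg_apply]
    rw [besselDiff_neg, ← besselCoeff_neg w (k + 1) s]
    ring_nf
  have h3 := ((h1.add h2).mul_left (2 : ℂ)⁻¹).nat_add_neg
  have hd0 : ∀ x, besselDiff w 0 x = 0 := fun x => by
    have := besselDiff_neg w 0 x
    rw [neg_zero] at this
    exact self_eq_neg.1 this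
  convert! h3 using 1
  · funext n
    have e1 := besselDiff_neg w n t
    have e2 := besselDiff_neg w n s
    simp only [besselDiff] at e1 e2 ⊢
    linear_combination (-(1 / 2 : ℂ)) * ((besselCoeff w (-n - 1) s - besselCoeff w (-n + 1) s) * e1
      - (besselCoeff w (n - 1) t - besselCoeff w (n + 1) t) * e2)
  · rw [hd0]
    ring

lemma norm_besselCoeff_le_div {w : ℝ} (hw : 0 < w) (n : ℕ) {s t : ℝ} (hs : |s| ≤ |t|) :
    ‖besselCoeff w (n + 1) s‖ ≤ 2 * w * |t| / (n + 1) := by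
  have h := congrArg norm (int_mul_besselCoeff w (n + 1) s)
  have hn : ‖(((n : ℤ) + 1 : ℤ) : ℂ)‖ = n + 1 := by
    push_cast
    exact_mod_cast Complex.norm_natCast (n + 1)
  rw [norm_mul, hn, norm_mul, norm_mul, norm_mul, norm_I, norm_real, norm_real,
    Real.norm_of_nonneg hw.le, Real.norm_eq_abs] at h
  rw [le_div_iff₀ (by positivity), mul_comm, h]
  have := norm_besselDiff_le w (n + 1) s
  calc 1 * w * |s| * ‖besselDiff w (n + 1) s‖ ≤ 1 * w * |t| * 2 := by gcongr
    _ = _ := by ring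

/-- The convolution `∫₀ᵗ c_j(t-s) c_k(s) ds`. -/
noncomputable def besselConv (w : ℝ) (j k : ℤ) (t : ℝ) : ℂ :=
  ∫ s in (0 : ℝ)..t, besselCoeff w j (t - s) * besselCoeff w k s

lemma besselConv_rel (w : ℝ) (j k : ℤ) (t : ℝ) :
    I * w * (besselConv w j (k - 1) t + besselConv w j (k + 1) t
        - besselConv w (j - 1) k t - besselConv w (j + 1) k t)
      = besselCoeff w j 0 * besselCoeff w k t - besselCoeff w j t * besselCoeff w k 0 := by
  have hd : ∀ s : ℝ, HasDerivAt (fun s => besselCoeff w j (t - s) * besselCoeff w k s)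
      (I * w * (besselCoeff w j (t - s) * besselCoeff w (k - 1) s
        + besselCoeff w j (t - s) * besselCoeff w (k + 1) s
        - besselCoeff w (j - 1) (t - s) * besselCoeff w k s
        - besselCoeff w (j + 1) (t - s) * besselCoeff w k s)) s := by
    intro s
    have h1 := HasDerivAt.scomp s (hasDerivAt_besselCoeff w j (t - s))
      ((hasDerivAt_id s).const_sub t)
    refine (h1.mul (hasDerivAt_besselCoeff w k s)).congr_deriv ?_
    simp only [Function.comp_apply, neg_smul, one_smul]
    ring
  have h := intervalIntegral.integral_eq_sub_of_hasDerivAt (a := 0) (b := t)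
    (fun s _ => hd s) (Continuous.intervalIntegrable (by fun_prop) _ _)
  rw [intervalIntegral.integral_const_mul,
    intervalIntegral.integral_sub (Continuous.intervalIntegrable (by fun_prop) _ _)
      (Continuous.intervalIntegrable (by fun_prop) _ _),
    intervalIntegral.integral_sub (Continuous.intervalIntegrable (by fun_prop) _ _)
      (Continuous.intervalIntegrable (by fun_prop) _ _),
    intervalIntegral.integral_add (Continuous.intervalIntegrable (by fun_prop) _ _)
      (Continuous.intervalIntegrable (by fun_prop) _ _), sub_self, sub_zero] at h
  exact h

lemma norm_besselConv_le {w : ℝ} (hw : 0 < w) (j : ℤ) (n : ℕ) (t : ℝ) :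
    ‖besselConv w j (n + 1) t‖ ≤ 2 * w * |t| / (n + 1) * |t| := by
  have h := intervalIntegral.norm_integral_le_of_norm_le_const (a := 0) (b := t)
    (f := fun s => besselCoeff w j (t - s) * besselCoeff w (n + 1) s)
    (C := 2 * w * |t| / (n + 1)) fun s hs => by
      have hst : |s| ≤ |t| := by
        rcases Set.mem_uIoc.1 hs with h | h
        · rw [abs_of_pos h.1]; exact h.2.trans (le_abs_self t)
        · rw [abs_of_nonpos h.2, abs_of_nonpos (by linarith)]; linarith
      rw [norm_mul]
      calc _ ≤ 1 * (2 * w * |t| / (n + 1)) := by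
            gcongr
            · exact norm_besselCoeff_le w j _
            · exact norm_besselCoeff_le_div hw n hst
        _ = _ := one_mul _
  rwa [sub_zero] at h

lemma besselConv_shift {w : ℝ} (hw : 0 < w) (j k : ℕ) (t : ℝ) :
    besselConv w j (k + 1) t = besselConv w (j + 1) k t := by
  have hstep : ∀ j k : ℕ, besselConv w (j + 1 : ℕ) ((k + 1 : ℕ) + 1) t
        - besselConv w ((j + 1 : ℕ) + 1) (k + 1 : ℕ) t
      = besselConv w j (k + 1) t - besselConv w (j + 1) k t := by
    intro j k
    have h := besselConv_rel w (j + 1) (k + 1) t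
    rw [besselCoeff_zero_of_ne w (by omega), besselCoeff_zero_of_ne w (by omega), zero_mul,
      mul_zero, sub_zero] at h
    have hIw : I * (w : ℂ) ≠ 0 := mul_ne_zero I_ne_zero (by exact_mod_cast hw.ne')
    have h' := (mul_eq_zero.1 h).resolve_left hIw
    rw [add_sub_cancel_right, add_sub_cancel_right] at h'
    push_cast
    linear_combination h'
  have hiter : ∀ n : ℕ, besselConv w (j + n : ℕ) ((k + n : ℕ) + 1) t
        - besselConv w ((j + n : ℕ) + 1) (k + n : ℕ) t
      = besselConv w j (k + 1) t - besselConv w (j + 1) k t := by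
    intro n
    induction n with
    | zero => simp
    | succ n ih => exact (hstep (j + n) (k + n)).trans ih
  have hbound : ∀ n : ℕ, ‖besselConv w j (k + 1) t - besselConv w (j + 1) k t‖
      ≤ 4 * w * |t| * |t| * (1 / ((n : ℝ) + 1)) := by
    intro n
    rw [← hiter (n + 1)]
    refine (norm_sub_le _ _).trans ?_
    have h1 := norm_besselConv_le hw (j + (n + 1) : ℕ) (k + (n + 1)) t
    have h2 := norm_besselConv_le hw ((j + (n + 1) : ℕ) + 1) (k + n) t
    have h3 : (((k + (n + 1) : ℕ)) : ℤ) = ((k + n : ℕ) : ℤ) + 1 := by push_cast; ring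
    rw [← h3] at h2
    have h4 : 2 * w * |t| / (((k + (n + 1) : ℕ) : ℝ) + 1) * |t| ≤ 2 * w * |t| / (n + 1) * |t| := by
      gcongr
      linarith [(k.cast_nonneg : (0 : ℝ) ≤ k)]
    have h5 : 2 * w * |t| / (((k + n : ℕ) : ℝ) + 1) * |t| ≤ 2 * w * |t| / (n + 1) * |t| := by
      gcongr
      linarith
    calc _ ≤ 2 * w * |t| / (n + 1) * |t| + 2 * w * |t| / (n + 1) * |t| :=
          add_le_add (h1.trans h4) (h2.trans h5)
      _ = _ := by ring
  have hlim := (tendsto_one_div_add_atTop_nhds_zero_nat (𝕜 := ℝ)).const_mul (4 * w * |t| * |t|)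
  rw [mul_zero] at hlim
  exact sub_eq_zero.1 (norm_le_zero_iff.1 (ge_of_tendsto' hlim hbound))

lemma besselCoeff_zero_zero (w : ℝ) : besselCoeff w 0 0 = 1 := by
  have : besselWave w 0 0 = fun _ => 1 := by
    funext θ
    simp [besselWave]
  rw [besselCoeff, this, intervalIntegral.integral_const, sub_neg_eq_add, ← two_mul, real_smul]
  push_cast
  rw [mul_one, inv_mul_cancel₀ two_pi_complex_ne_zero]

/-- `w ∫₀ᵗ v(t-s) c_k(s) ds = -i c_{k+1}(t)`. -/
lemma integral_scFourier_mul_besselCoeff {w : ℝ} (hw : 0 < w) (k : ℕ) (t : ℝ) :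
    I * w * ∫ s in (0 : ℝ)..t, scFourier w (t - s) * besselCoeff w k s
      = besselCoeff w (k + 1) t := by
  have h1 : ∫ s in (0 : ℝ)..t, scFourier w (t - s) * besselCoeff w k s
      = besselConv w 0 k t - besselConv w 2 k t := by
    rw [besselConv, besselConv, ← intervalIntegral.integral_sub
      (Continuous.intervalIntegrable (by fun_prop) _ _)
      (Continuous.intervalIntegrable (by fun_prop) _ _)]
    refine intervalIntegral.integral_congr fun s _ => ?_
    rw [scFourier_eq_besselDiff hw, ← sub_mul]
    rfl
  have h2 := besselConv_rel w 0 (k + 1) t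
  have h3 : besselConv w (0 - 1) (k + 1) t = besselConv w (0 + 1) (k + 1) t := by
    simp only [besselConv, zero_sub, zero_add, besselCoeff_neg]
  have h4 := besselConv_shift hw 0 (k + 1) t
  have h5 := besselConv_shift hw 1 k t
  push_cast at h4 h5
  rw [besselCoeff_zero_zero, besselCoeff_zero_of_ne w (by omega), h3] at h2
  simp only [zero_add, add_sub_cancel_right] at h2 h4
  rw [h1]
  linear_combination h2 - I * w * (h4 - h5)

lemma integral_cos_add_int_mul (A : ℝ) (n : ℤ) :
    ∫ β in (-Real.pi)..Real.pi, Real.cos (A + n * β)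
      = if n = 0 then 2 * Real.pi * Real.cos A else 0 := by
  split_ifs with hn
  · simp only [hn, Int.cast_zero, zero_mul, add_zero, intervalIntegral.integral_const, smul_eq_mul]
    ring
  · have hn' : (n : ℝ) ≠ 0 := by exact_mod_cast hn
    have hd : ∀ β : ℝ, HasDerivAt (fun β => Real.sin (A + n * β) / n) (Real.cos (A + n * β)) β := by
      intro β
      have h1 : HasDerivAt (fun β : ℝ => A + n * β) n β := by
        simpa using ((hasDerivAt_id β).const_mul (n : ℝ)).const_add A
      refine (h1.sin.div_const (n : ℝ)).congr_deriv ?_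
      field_simp
    rw [intervalIntegral.integral_eq_sub_of_hasDerivAt (fun β _ => hd β)
      (Continuous.intervalIntegrable (by fun_prop) _ _), mul_neg, ← sub_eq_add_neg, Real.sin_add,
      Real.sin_sub, Real.sin_int_mul_pi]
    ring

/-- The kernel of `Fthree` in angular coordinates, applied to the Chebyshev polynomials
`T_k` and `T_l`. -/
noncomputable def chebyshevKernel (k l : ℕ) (α β : ℝ) : ℝ :=
  (Real.cos (k * β) - Real.cos (k * α)) * (Real.cos (l * β) - Real.cos (l * α))
    / (Real.cos α - Real.cos β) ^ 2 * (1 - Real.cos α * Real.cos β)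

/-- The trigonometric polynomial
`(cos kβ - cos kα) (cos lβ - cos lα) / |e^{iβ} - e^{iα}|²`. -/
noncomputable def circleKernel (k l : ℕ) (α β : ℝ) : ℝ :=
  ∑ i ∈ Finset.range k, ∑ j ∈ Finset.range l,
    (Real.cos ((((k - 1 - i : ℕ) : ℝ) - (l - 1 - j : ℕ)) * α + ((i - j : ℤ) : ℝ) * β)
      - Real.cos ((((k - 1 - i : ℕ) : ℝ) + (l - 1 - j : ℕ) + 1) * α + ((i + j + 1 : ℤ) : ℝ) * β)) / 2

@[fun_prop]
lemma continuous_circleKernel (k l : ℕ) (α : ℝ) : Continuous (circleKernel k l α) := by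
  unfold circleKernel
  fun_prop

lemma abs_circleKernel_le (k l : ℕ) (α β : ℝ) : |circleKernel k l α β| ≤ k * l := by
  have h : ∀ x y : ℝ, |(Real.cos x - Real.cos y) / 2| ≤ 1 := fun x y => by
    rw [abs_le]
    constructor <;> linarith [Real.cos_le_one x, Real.neg_one_le_cos x, Real.cos_le_one y,
      Real.neg_one_le_cos y]
  refine (Finset.abs_sum_le_sum_abs _ _).trans ?_
  refine (Finset.sum_le_sum fun i _ => (Finset.abs_sum_le_sum_abs _ _).trans
    (Finset.sum_le_sum fun j _ => h _ _)).trans ?_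
  simp

lemma circleKernel_mul (k l : ℕ) (α β : ℝ) :
    (Real.cos (k * β) - Real.cos (k * α)) * (Real.cos (l * β) - Real.cos (l * α))
      = (2 - 2 * Real.cos (α - β)) * circleKernel k l α β := by
  set z : ℂ := exp (α * I) with hz
  set u : ℂ := exp (β * I) with hu
  let G : ℕ → ℂ := fun k => ∑ i ∈ Finset.range k, u ^ i * z ^ (k - 1 - i)
  have hG : ∀ k, G k * (u - z) = u ^ k - z ^ k := fun k => (Commute.all u z).geom_sum₂_mul k
  have hzpow : ∀ n : ℕ, z ^ n = exp ((n * α : ℝ) * I) := fun n => by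
    rw [hz, ← exp_nat_mul]
    push_cast
    ring_nf
  have hupow : ∀ n : ℕ, u ^ n = exp ((n * β : ℝ) * I) := fun n => by
    rw [hu, ← exp_nat_mul]
    push_cast
    ring_nf
  have hcos : ∀ k : ℕ, Real.cos (k * β) - Real.cos (k * α) = (G k * (u - z)).re := fun k => by
    rw [hG, sub_re, hzpow, hupow, exp_ofReal_mul_I_re, exp_ofReal_mul_I_re]
  have hconj : ∀ x : ℝ, (starRingEnd ℂ) (exp (x * I)) = exp ((-x : ℝ) * I) := fun x => by
    rw [← exp_conj, map_mul, conj_I, conj_ofReal]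
    push_cast
    ring_nf
  have hker : circleKernel k l α β
      = ((G k * (starRingEnd ℂ) (G l) - z * u * (G k * G l)) / 2).re := by
    have hexpand : (G k * (starRingEnd ℂ) (G l) - z * u * (G k * G l)) / 2
        = ∑ i ∈ Finset.range k, ∑ j ∈ Finset.range l,
          (exp (((((k - 1 - i : ℕ) : ℝ) - (l - 1 - j : ℕ)) * α + ((i - j : ℤ) : ℝ) * β : ℝ) * I)
          - exp (((((k - 1 - i : ℕ) : ℝ) + (l - 1 - j : ℕ) + 1) * α + ((i + j + 1 : ℤ) : ℝ) * β : ℝ)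
            * I)) / 2 := by
      simp only [G, map_sum]
      rw [Finset.sum_mul_sum, Finset.sum_mul_sum]
      simp only [Finset.mul_sum, ← Finset.sum_sub_distrib, Finset.sum_div]
      refine Finset.sum_congr rfl fun i _ => Finset.sum_congr rfl fun j _ => ?_
      rw [hupow, hupow, hzpow, hzpow, hz, hu, map_mul, hconj, hconj]
      simp only [← exp_add]
      congr 2
      · congr 1
        push_cast
        ring
      · congr 1
        push_cast
        ring
    rw [hexpand, re_sum, circleKernel]
    refine Finset.sum_congr rfl fun i _ => ?_
    rw [re_sum]
    refine Finset.sum_congr rfl fun j _ => ?_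
    rw [div_ofNat_re, sub_re, exp_ofReal_mul_I_re, exp_ofReal_mul_I_re]
  have hD : (u - z) ^ 2 = -(z * u) * ((2 - 2 * Real.cos (α - β) : ℝ) : ℂ) := by
    have h1 : exp (-(α * I)) * z = 1 := by rw [hz, ← exp_add]; simp
    have h2 : exp (-(β * I)) * u = 1 := by rw [hu, ← exp_add]; simp
    have h3 : 2 * cos ((α : ℂ) - β) = z * exp (-(β * I)) + u * exp (-(α * I)) := by
      rw [two_cos, hz, hu, ← exp_add, ← exp_add]
      ring_nf
    push_cast
    rw [h3]
    linear_combination (-(u ^ 2)) * h1 - z ^ 2 * h2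
  have hN : (u - z) * (starRingEnd ℂ) (u - z) = ((2 - 2 * Real.cos (α - β) : ℝ) : ℂ) := by
    have h1 : z * u ≠ 0 := mul_ne_zero (exp_ne_zero _) (exp_ne_zero _)
    have h2 : (starRingEnd ℂ) z * z = 1 := by rw [hz, hconj, ← exp_add]; simp
    have h3 : (starRingEnd ℂ) u * u = 1 := by rw [hu, hconj, ← exp_add]; simp
    refine mul_left_cancel₀ h1 ?_
    rw [map_sub]
    linear_combination -hD + (u - z) * z * h3 - (u - z) * u * h2
  have hre : ∀ a b : ℂ, a.re * b.re = ((a * (starRingEnd ℂ) b + a * b) / 2).re := fun a b => by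
    simp
  rw [hcos, hcos, hre, hker, ← re_ofReal_mul]
  congr 1
  rw [map_mul]
  linear_combination (1 / 2 : ℂ) * G k * (starRingEnd ℂ) (G l) * hN + (1 / 2 : ℂ) * G k * G l * hD

lemma chebyshevKernel_eq {k l : ℕ} {α β : ℝ} (h : Real.cos α ≠ Real.cos β) :
    chebyshevKernel k l α β = circleKernel k l α β + circleKernel k l α (-β) := by
  have h1 := circleKernel_mul k l α β
  have h2 := circleKernel_mul k l α (-β)
  rw [mul_neg, mul_neg, Real.cos_neg, Real.cos_neg, sub_neg_eq_add] at h2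
  have hA : (2 - 2 * Real.cos (α - β)) * (2 - 2 * Real.cos (α + β))
      = 4 * (Real.cos α - Real.cos β) ^ 2 := by
    rw [Real.cos_add, Real.cos_sub]
    linear_combination (-4 * Real.sin β ^ 2) * Real.sin_sq_add_cos_sq α
      + (4 * Real.cos α ^ 2 - 4) * Real.sin_sq_add_cos_sq β
  have hS : (2 - 2 * Real.cos (α - β)) + (2 - 2 * Real.cos (α + β))
      = 4 * (1 - Real.cos α * Real.cos β) := by
    rw [Real.cos_add, Real.cos_sub]
    ring
  have hne : (Real.cos α - Real.cos β) ^ 2 ≠ 0 := pow_ne_zero 2 (sub_ne_zero.2 h)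
  rw [chebyshevKernel, div_mul_eq_mul_div, div_eq_iff hne]
  refine mul_left_cancel₀ (four_ne_zero (α := ℝ)) ?_
  linear_combination (-(Real.cos (k * β) - Real.cos (k * α))
    * (Real.cos (l * β) - Real.cos (l * α))) * hS
    + (2 - 2 * Real.cos (α + β)) * h1 + (2 - 2 * Real.cos (α - β)) * h2
    + (circleKernel k l α β + circleKernel k l α (-β)) * hA

lemma abs_chebyshevKernel_le (k l : ℕ) (α β : ℝ) : |chebyshevKernel k l α β| ≤ 2 * (k * l) := by
  by_cases h : Real.cos α = Real.cos β
  · rw [chebyshevKernel, h, sub_self]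
    simp only [ne_eq, OfNat.ofNat_ne_zero, not_false_eq_true, zero_pow, div_zero, zero_mul,
      abs_zero]
    positivity
  · rw [chebyshevKernel_eq h]
    have := (abs_add_le _ _).trans
      (add_le_add (abs_circleKernel_le k l α β) (abs_circleKernel_le k l α (-β)))
    linarith

@[fun_prop]
lemma measurable_chebyshevKernel (k l : ℕ) (α : ℝ) : Measurable (chebyshevKernel k l α) := by
  unfold chebyshevKernel
  fun_prop

lemma integral_circleKernel (k l : ℕ) (α : ℝ) :
    ∫ β in (-Real.pi)..Real.pi, circleKernel k l α β
      = Real.pi * min k l * Real.cos (((k : ℤ) - l : ℤ) * α) := by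
  simp only [circleKernel]
  rw [intervalIntegral.integral_finsetSum
    fun i _ => Continuous.intervalIntegrable (by fun_prop) _ _]
  have hterm : ∀ i ∈ Finset.range k,
      (∫ β in (-Real.pi)..Real.pi, ∑ j ∈ Finset.range l,
        (Real.cos ((((k - 1 - i : ℕ) : ℝ) - (l - 1 - j : ℕ)) * α + ((i - j : ℤ) : ℝ) * β)
        - Real.cos ((((k - 1 - i : ℕ) : ℝ) + (l - 1 - j : ℕ) + 1) * α
          + ((i + j + 1 : ℤ) : ℝ) * β)) / 2)
      = if i < l then Real.pi * Real.cos (((k : ℤ) - l : ℤ) * α) else 0 := by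
    intro i hi
    rw [intervalIntegral.integral_finsetSum
      fun j _ => Continuous.intervalIntegrable (by fun_prop) _ _]
    have hj : ∀ j ∈ Finset.range l, (∫ β in (-Real.pi)..Real.pi,
        (Real.cos ((((k - 1 - i : ℕ) : ℝ) - (l - 1 - j : ℕ)) * α + ((i - j : ℤ) : ℝ) * β)
        - Real.cos ((((k - 1 - i : ℕ) : ℝ) + (l - 1 - j : ℕ) + 1) * α
          + ((i + j + 1 : ℤ) : ℝ) * β)) / 2)
        = if i = j then Real.pi * Real.cos (((k : ℤ) - l : ℤ) * α) else 0 := by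
      intro j hj
      rw [intervalIntegral.integral_div, intervalIntegral.integral_sub
        (Continuous.intervalIntegrable (by fun_prop) _ _)
        (Continuous.intervalIntegrable (by fun_prop) _ _), integral_cos_add_int_mul,
        integral_cos_add_int_mul, if_neg (by omega : ¬ ((i : ℤ) + j + 1 = 0))]
      by_cases hij : i = j
      · subst hij
        rw [if_pos (sub_self _), if_pos rfl]
        rw [Finset.mem_range] at hi hj
        have e : (((k - 1 - i : ℕ) : ℝ) - (l - 1 - i : ℕ)) = (((k : ℤ) - l : ℤ) : ℝ) := by
          have : ((k - 1 - i : ℕ) : ℤ) - (l - 1 - i : ℕ) = (k : ℤ) - l := by omega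
          exact_mod_cast this
        rw [e]
        ring
      · rw [if_neg (by omega), if_neg hij]
        ring
    rw [Finset.sum_congr rfl hj, Finset.sum_ite_eq]
    simp only [Finset.mem_range]
  rw [Finset.sum_congr rfl hterm, ← Finset.sum_filter, Finset.sum_const]
  have hcard : ((Finset.range k).filter (· < l)).card = min k l := by
    have : (Finset.range k).filter (· < l) = Finset.range (min k l) := by
      ext i
      simp
    rw [this, Finset.card_range]
  rw [hcard, nsmul_eq_mul]
  push_cast
  ring

lemma integral_chebyshevKernel (k l : ℕ) (α : ℝ) :
    ∫ β in (0 : ℝ)..Real.pi, chebyshevKernel k l α β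
      = Real.pi * min k l * Real.cos (((k : ℤ) - l : ℤ) * α) := by
  rw [← integral_circleKernel, integral_neg_pi_pi_eq (by fun_prop)]
  refine intervalIntegral.integral_congr_ae ?_
  have hae : ∀ᵐ β : ℝ, β ≠ Real.arccos (Real.cos α) := by
    simp [ae_iff, measure_singleton]
  filter_upwards [hae] with β hβ hmem
  rw [Set.uIoc_of_le Real.pi_pos.le] at hmem
  refine chebyshevKernel_eq fun h => hβ ?_
  rw [h, Real.arccos_cos hmem.1.le hmem.2]

lemma integral_integral_chebyshevKernel (k l : ℕ) :
    ∫ α in (0 : ℝ)..Real.pi, ∫ β in (0 : ℝ)..Real.pi, chebyshevKernel k l α β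
      = if k = l then Real.pi ^ 2 * k else 0 := by
  simp only [integral_chebyshevKernel]
  rw [intervalIntegral.integral_const_mul]
  have h := integral_cos_add_int_mul 0 ((k : ℤ) - l)
  rw [integral_neg_pi_pi_eq (by fun_prop)] at h
  simp only [zero_add, mul_neg, Real.cos_neg, ← two_mul, Real.cos_zero, mul_one] at h
  rw [intervalIntegral.integral_const_mul] at h
  by_cases hkl : k = l
  · subst hkl
    rw [if_pos (sub_self _)] at h
    rw [if_pos rfl, min_self]
    linear_combination (Real.pi * k / 2) * h
  · rw [if_neg (by omega)] at h
    rw [if_neg hkl]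
    linear_combination (Real.pi * (min k l : ℕ) / 2) * h

lemma Fthree_eq_integral_angles {w : ℝ} (hw : 0 < w) (s t : ℝ) :
    Fthree w s t = ((1 / (2 * Real.pi ^ 2) : ℝ) : ℂ)
      * ∫ α in (0 : ℝ)..Real.pi, ∫ β in (0 : ℝ)..Real.pi,
        (exp (((2 * w * s * Real.cos β : ℝ) : ℂ) * I) - exp (((2 * w * s * Real.cos α : ℝ) : ℂ) * I))
        * (exp (((2 * w * t * Real.cos β : ℝ) : ℂ) * I)
          - exp (((2 * w * t * Real.cos α : ℝ) : ℂ) * I))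
        * (((1 - Real.cos α * Real.cos β) / (Real.cos α - Real.cos β) ^ 2 : ℝ) : ℂ) := by
  rw [Fthree, integral_eq_integral_two_mul_cos hw]
  congr 1
  refine intervalIntegral.integral_congr_Ioo_of_le Real.pi_pos.le fun α hα => ?_
  rw [integral_eq_integral_two_mul_cos hw, ← intervalIntegral.integral_smul]
  refine intervalIntegral.integral_congr_Ioo_of_le Real.pi_pos.le fun β hβ => ?_
  have hsα := Real.sin_pos_of_mem_Ioo hα
  have hsβ := Real.sin_pos_of_mem_Ioo hβ
  have hexp : ∀ r θ : ℝ, exp (I * r * ((2 * w * Real.cos θ : ℝ) : ℂ))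
      = exp (((2 * w * r * Real.cos θ : ℝ) : ℂ) * I) := fun r θ => by
    congr 1
    push_cast
    ring
  have hweight : (2 * w * Real.sin α) * ((2 * w * Real.sin β)
      * (((2 * w * Real.cos α - 2 * w * Real.cos β) ^ 2)⁻¹
        * ((4 * w ^ 2 - 2 * w * Real.cos α * (2 * w * Real.cos β))
          / (2 * w * Real.sin α * (2 * w * Real.sin β)))))
      = (1 - Real.cos α * Real.cos β) / (Real.cos α - Real.cos β) ^ 2 := by
    rw [← mul_sub, mul_pow, mul_inv]
    field_simp
    ring
  simp only [hexp, sqrt_sub_two_mul_cos_sq hw (Set.Ioo_subset_Icc_self hα),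
    sqrt_sub_two_mul_cos_sq hw (Set.Ioo_subset_Icc_self hβ), real_smul]
  rw [← hweight]
  simp only [div_eq_mul_inv, ofReal_mul, ofReal_inv]
  ring

lemma hasSum_exp_cos_sub (w t α β : ℝ) :
    HasSum (fun n : ℕ => 2 * besselCoeff w n t
        * ((Real.cos (n * β) - Real.cos (n * α) : ℝ) : ℂ))
      (exp (((2 * w * t * Real.cos β : ℝ) : ℂ) * I)
        - exp (((2 * w * t * Real.cos α : ℝ) : ℂ) * I)) := by
  have h := ((hasSum_besselCoeff_exp w t β).sub (hasSum_besselCoeff_exp w t α)).nat_add_neg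
  convert! h using 1
  · funext n
    have hcos : ∀ θ : ℝ, 2 * (Real.cos (n * θ) : ℂ)
        = exp (((n : ℤ) : ℂ) * θ * I) + exp (((-n : ℤ) : ℂ) * θ * I) := fun θ => by
      push_cast
      rw [two_cos]
      ring_nf
    rw [besselCoeff_neg, ofReal_sub]
    linear_combination besselCoeff w n t * (hcos β - hcos α)
  · simp

lemma HasSum.mul_of_summable_norm {ι κ : Type*} {f : ι → ℂ} {g : κ → ℂ} {a b : ℂ}
    (hf : HasSum f a) (hg : HasSum g b) (hf' : Summable fun i => ‖f i‖)
    (hg' : Summable fun i => ‖g i‖) : HasSum (fun p : ι × κ => f p.1 * g p.2) (a * b) :=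
  hf.mul hg (summable_mul_of_summable_norm hf' hg')

lemma hasSum_Fthree_integrand (w s t α β : ℝ) :
    HasSum (fun p : ℕ × ℕ => 4 * besselCoeff w p.1 s * besselCoeff w p.2 t
        * (chebyshevKernel p.1 p.2 α β : ℂ))
      ((exp (((2 * w * s * Real.cos β : ℝ) : ℂ) * I) - exp (((2 * w * s * Real.cos α : ℝ) : ℂ) * I))
        * (exp (((2 * w * t * Real.cos β : ℝ) : ℂ) * I)
          - exp (((2 * w * t * Real.cos α : ℝ) : ℂ) * I))
        * (((1 - Real.cos α * Real.cos β) / (Real.cos α - Real.cos β) ^ 2 : ℝ) : ℂ)) := by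
  have hs : ∀ r : ℝ, Summable fun n : ℕ => ‖2 * besselCoeff w n r
      * ((Real.cos (n * β) - Real.cos (n * α) : ℝ) : ℂ)‖ := fun r => by
    refine ((summable_norm_besselCoeff_nat w r).mul_left 4).of_nonneg_of_le
      (fun n => norm_nonneg _) fun n => ?_
    have hc : ‖((Real.cos (n * β) - Real.cos (n * α) : ℝ) : ℂ)‖ ≤ 2 := by
      rw [norm_real, Real.norm_eq_abs, abs_le]
      constructor <;> linarith [Real.cos_le_one (n * α), Real.neg_one_le_cos (n * α),
        Real.cos_le_one (n * β), Real.neg_one_le_cos (n * β)]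
    rw [norm_mul, norm_mul, Complex.norm_ofNat]
    calc _ ≤ 2 * ‖besselCoeff w n r‖ * 2 := by gcongr
      _ = _ := by ring
  have hmul := (hasSum_exp_cos_sub w s α β).mul_of_summable_norm (hasSum_exp_cos_sub w t α β)
    (hs s) (hs t)
  refine (hmul.mul_right _).congr_fun fun p => ?_
  rw [chebyshevKernel]
  push_cast
  ring

lemma hasSum_Fthree {w : ℝ} (hw : 0 < w) (s t : ℝ) :
    HasSum (fun n : ℕ => 2 * n * besselCoeff w n s * besselCoeff w n t) (Fthree w s t) := by
  let B : ℕ × ℕ → ℝ := fun p =>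
    8 * ((p.1 * ‖besselCoeff w p.1 s‖) * (p.2 * ‖besselCoeff w p.2 t‖))
  have hB : Summable B :=
    ((summable_natCast_mul_norm_besselCoeff w s).mul_of_nonneg
      (summable_natCast_mul_norm_besselCoeff w t) (fun n => by positivity)
      (fun n => by positivity)).mul_left 8
  have hbound : ∀ (p : ℕ × ℕ) (α β : ℝ), ‖4 * besselCoeff w p.1 s * besselCoeff w p.2 t
      * (chebyshevKernel p.1 p.2 α β : ℂ)‖ ≤ B p := fun p α β => by
    rw [norm_mul, norm_mul, norm_mul, norm_real, Real.norm_eq_abs, Complex.norm_ofNat]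
    calc _ ≤ 4 * ‖besselCoeff w p.1 s‖ * ‖besselCoeff w p.2 t‖ * (2 * (p.1 * p.2)) := by
          gcongr
          exact abs_chebyshevKernel_le _ _ _ _
      _ = B p := by simp only [B]; ring
  have hinner : ∀ (p : ℕ × ℕ) (α : ℝ), ∫ β in (0 : ℝ)..Real.pi,
      4 * besselCoeff w p.1 s * besselCoeff w p.2 t * (chebyshevKernel p.1 p.2 α β : ℂ)
      = 4 * besselCoeff w p.1 s * besselCoeff w p.2 t
        * ((∫ β in (0 : ℝ)..Real.pi, chebyshevKernel p.1 p.2 α β : ℝ) : ℂ) := fun p α => by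
    rw [intervalIntegral.integral_const_mul, intervalIntegral.integral_ofReal]
  have hcont : ∀ k l : ℕ,
      Continuous fun α => ∫ β in (0 : ℝ)..Real.pi, chebyshevKernel k l α β := fun k l => by
    simp only [integral_chebyshevKernel]
    fun_prop
  have h1 := fun α : ℝ => intervalIntegral.hasSum_integral_of_dominated_convergence (μ := volume)
    (a := 0) (b := Real.pi) (fun p _ => B p)
    (fun p => Measurable.aestronglyMeasurable (by fun_prop))
    (fun p => Filter.Eventually.of_forall fun β _ => hbound p α β)
    (Filter.Eventually.of_forall fun β _ => hB) intervalIntegrable_const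
    (Filter.Eventually.of_forall fun β _ => hasSum_Fthree_integrand w s t α β)
  have h2 := intervalIntegral.hasSum_integral_of_dominated_convergence (μ := volume)
    (a := 0) (b := Real.pi) (fun p _ => B p * |Real.pi - 0|)
    (fun p => by
      simp only [hinner]
      exact Continuous.aestronglyMeasurable
        (continuous_const.mul (continuous_ofReal.comp (hcont p.1 p.2))))
    (fun p => Filter.Eventually.of_forall fun α _ =>
      intervalIntegral.norm_integral_le_of_norm_le_const fun β _ => hbound p α β)
    (Filter.Eventually.of_forall fun α _ => hB.mul_right _) intervalIntegrable_const
    (Filter.Eventually.of_forall fun α _ => h1 α)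
  have h3 := h2.mul_left ((1 / (2 * Real.pi ^ 2) : ℝ) : ℂ)
  rw [← Fthree_eq_integral_angles hw] at h3
  have hterm : ∀ p : ℕ × ℕ, ((1 / (2 * Real.pi ^ 2) : ℝ) : ℂ) * ∫ α in (0 : ℝ)..Real.pi,
      ∫ β in (0 : ℝ)..Real.pi,
        4 * besselCoeff w p.1 s * besselCoeff w p.2 t * (chebyshevKernel p.1 p.2 α β : ℂ)
      = if p.1 = p.2 then 2 * p.1 * besselCoeff w p.1 s * besselCoeff w p.2 t else 0 := fun p => by
    have hpi : (Real.pi : ℂ) ≠ 0 := by exact_mod_cast Real.pi_ne_zero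
    simp only [hinner]
    rw [intervalIntegral.integral_const_mul, intervalIntegral.integral_ofReal,
      integral_integral_chebyshevKernel]
    split_ifs
    · push_cast
      field_simp
      ring
    · simp
  simp only [hterm] at h3
  have hdiag : Function.Injective fun n : ℕ => (n, n) := fun m n h => congrArg Prod.fst h
  have h4 := (hdiag.hasSum_iff fun p hp => if_neg fun h => hp ⟨p.1, Prod.ext rfl h⟩).2 h3
  simpa [Function.comp_def] using h4

lemma continuous_scFourier {w : ℝ} (hw : 0 < w) : Continuous (scFourier w) := by
  rw [funext (scFourier_eq_besselDiff hw)]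
  unfold besselDiff
  fun_prop

lemma norm_scFourier_le {w : ℝ} (hw : 0 < w) (t : ℝ) : ‖scFourier w t‖ ≤ 2 := by
  rw [scFourier_eq_besselDiff hw]
  exact norm_besselDiff_le w 1 t

lemma norm_Fthree_deriv_term_le {w : ℝ} (hw : 0 < w) (s t : ℝ) (n : ℕ) :
    ‖2 * n * besselCoeff w n s * (I * w * (besselCoeff w (n - 1) t + besselCoeff w (n + 1) t))‖
      ≤ 4 * w * (n * ‖besselCoeff w n s‖) := by
  rw [norm_mul, norm_mul, norm_mul, norm_mul, norm_mul, norm_I, Complex.norm_ofNat, norm_natCast,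
    norm_real, Real.norm_of_nonneg hw.le]
  have h : ‖besselCoeff w (n - 1) t + besselCoeff w (n + 1) t‖ ≤ 1 + 1 :=
    (norm_add_le _ _).trans
      (add_le_add (norm_besselCoeff_le w (n - 1) t) (norm_besselCoeff_le w (n + 1) t))
  calc _ ≤ 2 * n * ‖besselCoeff w n s‖ * (1 * w * (1 + 1)) := by gcongr
    _ = _ := by ring

lemma hasDerivAt_Fthree_tsum {w : ℝ} (hw : 0 < w) (s t : ℝ) :
    HasDerivAt (fun t => Fthree w t s)
      (∑' n : ℕ, 2 * n * besselCoeff w n s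
        * (I * w * (besselCoeff w (n - 1) t + besselCoeff w (n + 1) t))) t := by
  have hF : (fun t => Fthree w t s)
      = fun t => ∑' n : ℕ, 2 * n * besselCoeff w n s * besselCoeff w n t := by
    funext t
    rw [← (hasSum_Fthree hw t s).tsum_eq]
    exact tsum_congr fun n => by ring
  rw [hF]
  have hsum : Summable fun n : ℕ => 2 * n * besselCoeff w n s * besselCoeff w n 0 :=
    (hasSum_Fthree hw s 0).summable
  refine hasDerivAt_tsum ((summable_natCast_mul_norm_besselCoeff w s).mul_left (4 * w))
    (fun n y => (hasDerivAt_besselCoeff w n y).const_mul _)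
    (fun n y => norm_Fthree_deriv_term_le hw s y n) hsum t

lemma summable_deriv_Fthree {w : ℝ} (hw : 0 < w) (s t : ℝ) :
    Summable fun n : ℕ => 2 * n * besselCoeff w n s
        * (I * w * (besselCoeff w (n - 1) t + besselCoeff w (n + 1) t)) :=
  ((summable_natCast_mul_norm_besselCoeff w s).mul_left (4 * w)).of_norm_bounded
    (norm_Fthree_deriv_term_le hw s t)

lemma hasSum_scFourier_conv_Fthree {w : ℝ} (hw : 0 < w) (s t : ℝ) :
    HasSum (fun n : ℕ => 2 * n * besselCoeff w n s
        * ∫ x in (0 : ℝ)..t, scFourier w (t - x) * besselCoeff w n x)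
      (∫ x in (0 : ℝ)..t, scFourier w (t - x) * Fthree w x s) := by
  have hv := continuous_scFourier hw
  have h := intervalIntegral.hasSum_integral_of_dominated_convergence (μ := volume)
    (a := 0) (b := t)
    (F := fun (n : ℕ) x => 2 * n * besselCoeff w n s * (scFourier w (t - x) * besselCoeff w n x))
    (f := fun x => scFourier w (t - x) * Fthree w x s)
    (fun n _ => 4 * (n * ‖besselCoeff w n s‖))
    (fun n => Continuous.aestronglyMeasurable (by fun_prop))
    (fun n => Filter.Eventually.of_forall fun x _ => by
      rw [norm_mul, norm_mul, norm_mul, norm_mul, Complex.norm_ofNat, norm_natCast]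
      have h1 := norm_scFourier_le hw (t - x)
      have h2 := norm_besselCoeff_le w n x
      calc _ ≤ 2 * n * ‖besselCoeff w n s‖ * (2 * 1) := by gcongr
        _ = _ := by ring)
    (Filter.Eventually.of_forall fun x _ =>
      (summable_natCast_mul_norm_besselCoeff w s).mul_left 4)
    intervalIntegrable_const
    (Filter.Eventually.of_forall fun x _ => by
      refine ((hasSum_Fthree hw x s).mul_left (scFourier w (t - x))).congr_fun fun n => ?_
      ring)
  refine h.congr_fun fun n => ?_
  rw [intervalIntegral.integral_const_mul]

lemma hasDerivAt_Fthree {w : ℝ} (hw : 0 < w) (s t : ℝ) :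
    HasDerivAt (fun t => Fthree w t s)
      (-(2 * (w ^ 2 : ℂ) * s) * scFourier w (s + t)
        - 2 * (w ^ 2 : ℂ) * ∫ x in (0 : ℝ)..t, scFourier w (t - x) * Fthree w x s) t := by
  refine (hasDerivAt_Fthree_tsum hw s t).congr_deriv ?_
  have h1 := (summable_deriv_Fthree hw s t).hasSum.add
    ((hasSum_scFourier_conv_Fthree hw s t).mul_left (2 * (w ^ 2 : ℂ)))
  have h2 := (hasSum_besselDiff_mul hw s t).mul_left (-(2 * (w ^ 2 : ℂ) * s))
  refine eq_sub_of_add_eq (h1.unique (h2.congr_fun fun n => ?_))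
  have hc := integral_scFourier_mul_besselCoeff hw n t
  have hn := int_mul_besselCoeff w n s
  have hd : besselDiff w n t = besselCoeff w (n - 1) t - besselCoeff w (n + 1) t := rfl
  rw [Int.cast_natCast] at hn
  rw [hd]
  linear_combination (-4 * I * w * n * besselCoeff w n s) * hc
    + 2 * I * w * (besselCoeff w (n - 1) t - besselCoeff w (n + 1) t) * hn
    + (2 * w ^ 2 * s * besselDiff w n s * (besselCoeff w (n - 1) t - besselCoeff w (n + 1) t)
      + 4 * w ^ 2 * n * besselCoeff w n s
        * ∫ x in (0 : ℝ)..t, scFourier w (t - x) * besselCoeff w n x) * I_sq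

lemma continuous_Fthree {w : ℝ} (hw : 0 < w) (s : ℝ) : Continuous fun t => Fthree w t s :=
  continuous_iff_continuousAt.2 fun t => (hasDerivAt_Fthree hw s t).continuousAt

lemma continuous_conv {v f : ℝ → ℂ} (hv : Continuous v) (hf : Continuous f) :
    Continuous fun t : ℝ => ∫ x in (0 : ℝ)..t, v (t - x) * f x :=
  intervalIntegral.continuous_parametric_intervalIntegral_of_continuous
    (f := fun t x => v (t - x) * f x) (by fun_prop) continuous_id

lemma Fthree_zero {w : ℝ} (hw : 0 < w) (s : ℝ) : Fthree w 0 s = 0 := by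
  refine (hasSum_Fthree hw 0 s).unique (hasSum_zero.congr_fun fun n => ?_)
  rcases eq_or_ne n 0 with rfl | hn
  · simp
  · rw [besselCoeff_zero_of_ne w (by exact_mod_cast hn)]
    ring

lemma Fthree_integral_equation {w : ℝ} (hw : 0 < w) (s t : ℝ) :
    Fthree w t s + 2 * (w ^ 2 : ℂ) * ∫ y in (0 : ℝ)..t, ∫ x in (0 : ℝ)..y,
        scFourier w (y - x) * Fthree w x s
      = -(2 * (w ^ 2 : ℂ) * s) * ∫ y in (0 : ℝ)..t, scFourier w (s + y) := by
  have hv := continuous_scFourier hw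
  have hconv := continuous_conv hv (continuous_Fthree hw s)
  have h := intervalIntegral.integral_eq_sub_of_hasDerivAt (a := 0) (b := t)
    (fun y _ => hasDerivAt_Fthree hw s y) (Continuous.intervalIntegrable (by fun_prop) _ _)
  rw [Fthree_zero hw, intervalIntegral.integral_sub
    (Continuous.intervalIntegrable (by fun_prop) _ _)
    (Continuous.intervalIntegrable (by fun_prop) _ _), intervalIntegral.integral_const_mul,
    intervalIntegral.integral_const_mul] at h
  linear_combination -h

/-- A homogeneous Volterra equation with bounded kernel has only the zero solution. -/
lemma eq_zero_of_add_integral_conv_eq_zero {v D : ℝ → ℂ} {C : ℝ} (c : ℂ)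
    (hv : ∀ t, ‖v t‖ ≤ C) (hD : ContinuousOn D (Set.Ici 0))
    (h : ∀ t : ℝ, 0 ≤ t →
      D t + c * ∫ y in (0 : ℝ)..t, ∫ x in (0 : ℝ)..y, v (y - x) * D x = 0)
    {t : ℝ} (ht : 0 ≤ t) : D t = 0 := by
  let E : ℝ → ℂ := fun x => D (max x 0)
  have hE : Continuous E := hD.comp_continuous (by fun_prop) fun x => le_max_right x 0
  have hED : ∀ x : ℝ, 0 ≤ x → E x = D x := fun x hx => by simp only [E, max_eq_left hx]
  have hC : 0 ≤ C := (norm_nonneg _).trans (hv 0)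
  let u : ℝ → ℝ := fun x => ∫ y in (0 : ℝ)..x, ‖E y‖
  have hu : ∀ x, HasDerivAt u ‖E x‖ x := fun x =>
    intervalIntegral.integral_hasDerivAt_right (hE.norm.intervalIntegrable _ _)
      hE.norm.stronglyMeasurable.stronglyMeasurableAtFilter hE.norm.continuousAt
  have hmono : Monotone u := monotone_of_hasDerivAt_nonneg hu fun x => norm_nonneg _
  have hu0 : u 0 = 0 := intervalIntegral.integral_same
  have hinner : ∀ y, 0 ≤ y → ‖∫ x in (0 : ℝ)..y, v (y - x) * D x‖ ≤ C * u y := fun y hy => by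
    rw [← intervalIntegral.integral_const_mul]
    refine intervalIntegral.norm_integral_le_of_norm_le hy
      (Filter.Eventually.of_forall fun x hx => ?_)
      ((hE.norm.const_mul C).intervalIntegrable _ _)
    rw [norm_mul, hED x hx.1.le]
    gcongr
    exact hv _
  have hbound : ∀ x ∈ Set.Ico 0 t, ‖‖E x‖‖ ≤ ‖c‖ * C * t * ‖u x‖ := fun x hx => by
    have hux : 0 ≤ u x := hu0 ▸ hmono hx.1
    have hi := intervalIntegral.norm_integral_le_of_norm_le_const (a := 0) (b := x)
      (f := fun y => ∫ x in (0 : ℝ)..y, v (y - x) * D x) (C := C * u x) fun y hy => by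
        rw [Set.uIoc_of_le hx.1] at hy
        exact (hinner y hy.1.le).trans (mul_le_mul_of_nonneg_left (hmono hy.2) hC)
    rw [norm_norm, hED x hx.1, eq_neg_of_add_eq_zero_left (h x hx.1), norm_neg, norm_mul,
      Real.norm_of_nonneg hux]
    rw [sub_zero, abs_of_nonneg hx.1] at hi
    calc _ ≤ ‖c‖ * (C * u x * t) := by
          gcongr
          exact hi.trans (mul_le_mul_of_nonneg_left hx.2.le (by positivity))
      _ = _ := by ring
  have hut : ∀ x ∈ Set.Icc 0 t, u x = 0 :=
    eq_zero_of_abs_deriv_le_mul_abs_self_of_eq_zero_right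
      (fun x _ => (hu x).continuousAt.continuousWithinAt) (fun x _ => (hu x).hasDerivWithinAt)
      hu0 hbound
  have hzero : ∀ y ∈ Set.uIoc 0 t, ∫ x in (0 : ℝ)..y, v (y - x) * D x = 0 := fun y hy => by
    rw [Set.uIoc_of_le ht] at hy
    have := hinner y hy.1.le
    rw [hut y ⟨hy.1.le, hy.2⟩, mul_zero] at this
    exact norm_le_zero_iff.1 this
  have hint : ∫ y in (0 : ℝ)..t, ∫ x in (0 : ℝ)..y, v (y - x) * D x = 0 :=
    intervalIntegral.integral_zero_ae (Filter.Eventually.of_forall hzero)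
  simpa [hint] using h t ht

/-- For fixed `t₂ ≥ 0`, `F₃(·,t₂)` is the unique differentiable solution on `[0,∞)` of
`F₃(t₁,t₂) + 2w² ∫₀^{t₁}∫₀^{t₃} v(t₃-t₄)F₃(t₄,t₂) dt₄ dt₃ = -2w² t₂ ∫₀^{t₁} v(t₂+t₃) dt₃`. -/
theorem scFourier_integral_equation_three (w : ℝ) (hw : 0 < w) (t₂ : ℝ) (ht₂ : 0 ≤ t₂) :
    DifferentiableOn ℝ (fun t₁ => Fthree w t₁ t₂) (Set.Ici 0)
    ∧ (∀ t₁ : ℝ, 0 ≤ t₁ →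
        Fthree w t₁ t₂
          + 2 * (w ^ 2 : ℂ) * ∫ t₃ in (0:ℝ)..t₁, ∫ t₄ in (0:ℝ)..t₃,
              scFourier w (t₃ - t₄) * Fthree w t₄ t₂
          = -(2 * (w ^ 2 : ℂ) * t₂) * ∫ t₃ in (0:ℝ)..t₁, scFourier w (t₂ + t₃))
    ∧ ∀ G : ℝ → ℂ, DifferentiableOn ℝ G (Set.Ici 0) →
        (∀ t₁ : ℝ, 0 ≤ t₁ →
          G t₁ + 2 * (w ^ 2 : ℂ) * ∫ t₃ in (0:ℝ)..t₁, ∫ t₄ in (0:ℝ)..t₃,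
              scFourier w (t₃ - t₄) * G t₄
            = -(2 * (w ^ 2 : ℂ) * t₂) * ∫ t₃ in (0:ℝ)..t₁, scFourier w (t₂ + t₃)) →
        ∀ t₁ : ℝ, 0 ≤ t₁ → G t₁ = Fthree w t₁ t₂ := by
  have hv := continuous_scFourier hw
  have hF := continuous_Fthree hw t₂
  refine ⟨fun t _ => (hasDerivAt_Fthree hw t₂ t).differentiableAt.differentiableWithinAt,
    fun t _ => Fthree_integral_equation hw t₂ t, fun G hG hGeq t ht => sub_eq_zero.1 ?_⟩
  have hGc : ContinuousOn (fun x => G (max x 0)) Set.univ :=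
    hG.continuousOn.comp (by fun_prop) fun x _ => le_max_right x 0
  rw [continuousOn_univ] at hGc
  refine eq_zero_of_add_integral_conv_eq_zero (v := scFourier w)
    (D := fun x => G x - Fthree w x t₂) (2 * (w ^ 2 : ℂ)) (norm_scFourier_le hw)
    (hG.continuousOn.sub hF.continuousOn) (fun r hr => ?_) ht
  have hconvG := continuous_conv hv hGc
  have hconvF := continuous_conv hv hF
  have hGmax : ∀ y : ℝ, 0 ≤ y → ∫ x in (0 : ℝ)..y, scFourier w (y - x) * G x
      = ∫ x in (0 : ℝ)..y, scFourier w (y - x) * G (max x 0) := fun y hy =>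
    intervalIntegral.integral_congr fun x hx => by
      rw [Set.uIcc_of_le hy] at hx
      simp only [max_eq_left hx.1]
  have hinner : ∀ y ∈ Set.uIcc 0 r,
      ∫ x in (0 : ℝ)..y, scFourier w (y - x) * (G x - Fthree w x t₂)
      = (∫ x in (0 : ℝ)..y, scFourier w (y - x) * G (max x 0))
        - ∫ x in (0 : ℝ)..y, scFourier w (y - x) * Fthree w x t₂ := fun y hy => by
    rw [Set.uIcc_of_le hr] at hy
    have hvG : Continuous fun x => scFourier w (y - x) * G (max x 0) :=
      Continuous.mul (by fun_prop) hGc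
    rw [← intervalIntegral.integral_sub (hvG.intervalIntegrable _ _)
      (Continuous.intervalIntegrable (by fun_prop) _ _)]
    refine intervalIntegral.integral_congr fun x hx => ?_
    rw [Set.uIcc_of_le hy.1] at hx
    simp only [max_eq_left hx.1, mul_sub]
  have hGr := hGeq r hr
  rw [intervalIntegral.integral_congr fun y hy => hGmax y (by
    rw [Set.uIcc_of_le hr] at hy; exact hy.1)] at hGr
  rw [intervalIntegral.integral_congr hinner, intervalIntegral.integral_sub
    (hconvG.intervalIntegrable _ _) (hconvF.intervalIntegrable _ _)]
  linear_combination hGr - Fthree_integral_equation hw t₂ r
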